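/- Let X be a compact metric space equipped with a Borel probability measure dx, and assume there exists a sequence (g_k)_{k≥1} in X such that W₁((1/n) ∑_{k=1}^n δ_{g_k}, dx) → 0 as n → ∞. Let f : ℕ → ℕ be nondecreasing with liminf_{N→∞} f(N)/N > 1. Then there exists N₀ such that for every sequence (x_i)_{i≥1} in X there exists a sequence (y_j)_{j≥1} in X with the following property: for every N ≥ N₀, writing μ_N = ∑_{i=1}^N δ_{x_i} − ∑_{j=1}^{f(N)} δ_{y_j}, one has 𝐖₁^{1,1}((1/(N+f(N))) μ_N, dx) > 𝐖₁^{1,1}((1/(N+f(N))) (−μ_N), dx). -/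

import Mathlib

open MeasureTheory Filter Metric
open scoped ENNReal

section Defs

variable {X : Type*} [MeasurableSpace X] [MetricSpace X]

/-- A transference plan (coupling) between `μ` and `ν`: a measure on `X × X`
whose marginals are `μ` and `ν`. -/
def IsCoupling (μ ν : Measure X) (π : Measure (X × X)) : Prop :=
  π.map Prod.fst = μ ∧ π.map Prod.snd = ν

/-- The 1-Wasserstein distance between two (nonnegative) measures of equal mass:
the infimum over couplings of the transport cost. -/
noncomputable def W1 (μ ν : Measure X) : ℝ :=
  sInf { r : ℝ | ∃ π : Measure (X × X), IsCoupling μ ν π ∧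
    r = ∫ p : X × X, dist p.1 p.2 ∂π }

/-- The total variation norm `‖μ - ν‖` of the difference of two finite measures. -/
noncomputable def tvNorm (μ ν : Measure X) : ℝ :=
  ((μ - ν) Set.univ + (ν - μ) Set.univ).toReal

/-- The generalized Wasserstein distance `W₁^{a,b}` between two finite nonnegative
measures, possibly of different total mass (Piccoli–Rossi). -/
noncomputable def genW (a b : ℝ) (μ ν : Measure X) : ℝ :=
  sInf { r : ℝ | ∃ μ' ν' : Measure X, IsFiniteMeasure μ' ∧ IsFiniteMeasure ν' ∧
    μ' Set.univ = ν' Set.univ ∧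
    r = a * (tvNorm μ μ' + tvNorm ν ν') + b * W1 μ' ν' }

/-- The signed generalized Wasserstein distance `𝐖₁^{a,b}` between finite signed
measures, defined via the Jordan decompositions. -/
noncomputable def signedW (a b : ℝ) (μ ν : SignedMeasure X) : ℝ :=
  genW a b (μ.toJordanDecomposition.posPart + ν.toJordanDecomposition.negPart)
    (μ.toJordanDecomposition.negPart + ν.toJordanDecomposition.posPart)

/-- The empirical (probability) measure of the first `n` points of a sequence. -/
noncomputable def emp (x : ℕ → X) (n : ℕ) : Measure X :=
  (n : ℝ≥0∞)⁻¹ • ∑ k ∈ Finset.range n, Measure.dirac (x k)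

/-- The (unnormalized) empirical signed measure of the first `n` points of a sequence. -/
noncomputable def sEmp (x : ℕ → X) (n : ℕ) : SignedMeasure X :=
  ∑ k ∈ Finset.range n, (Measure.dirac (x k)).toSignedMeasure

end Defs

section GeneralizedWasserstein

variable {X : Type*} [MeasurableSpace X]

lemma measureReal_univ_sub_sub (μ ν : Measure X) [IsFiniteMeasure μ] [IsFiniteMeasure ν] :
    (μ - ν).real Set.univ - (ν - μ).real Set.univ = μ.real Set.univ - ν.real Set.univ := by
  have h := congrArg (fun s : SignedMeasure X => s Set.univ)
    (Measure.sub_toSignedMeasure_eq_toSignedMeasure_sub (μ := μ) (ν := ν))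
  simpa [Measure.toSignedMeasure_apply_measurable] using h.symm

lemma measureReal_univ_sub_of_le {μ ν : Measure X} [IsFiniteMeasure μ] [IsFiniteMeasure ν]
    (h : ν ≤ μ) : (μ - ν).real Set.univ = μ.real Set.univ - ν.real Set.univ := by
  have := measureReal_univ_sub_sub μ ν
  rw [Measure.sub_eq_zero_of_le h] at this
  simpa using this

lemma tvNorm_eq (μ ν : Measure X) [IsFiniteMeasure μ] [IsFiniteMeasure ν] :
    tvNorm μ ν = (μ - ν).real Set.univ + (ν - μ).real Set.univ :=
  ENNReal.toReal_add (measure_ne_top _ _) (measure_ne_top _ _)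

lemma tvNorm_nonneg (μ ν : Measure X) : 0 ≤ tvNorm μ ν := ENNReal.toReal_nonneg

lemma abs_sub_le_tvNorm (μ ν : Measure X) [IsFiniteMeasure μ] [IsFiniteMeasure ν] :
    |μ.real Set.univ - ν.real Set.univ| ≤ tvNorm μ ν := by
  rw [tvNorm_eq, ← measureReal_univ_sub_sub, abs_le]
  have h₁ : 0 ≤ (μ - ν).real Set.univ := measureReal_nonneg
  have h₂ : 0 ≤ (ν - μ).real Set.univ := measureReal_nonneg
  constructor <;> linarith

lemma tvNorm_of_le {μ ν : Measure X} [IsFiniteMeasure μ] [IsFiniteMeasure ν] (h : μ ≤ ν) :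
    tvNorm μ ν = ν.real Set.univ - μ.real Set.univ := by
  rw [tvNorm_eq, Measure.sub_eq_zero_of_le h, measureReal_univ_sub_of_le h]
  simp

lemma tvNorm_comm (μ ν : Measure X) : tvNorm μ ν = tvNorm ν μ := by
  rw [tvNorm, tvNorm, add_comm]

variable [MetricSpace X]

lemma W1_nonneg (μ ν : Measure X) : 0 ≤ W1 μ ν := by
  refine Real.sInf_nonneg ?_
  rintro _ ⟨π, -, rfl⟩
  exact integral_nonneg fun _ => dist_nonneg

lemma genW_one_le (μ ν μ' ν' : Measure X) [IsFiniteMeasure μ'] [IsFiniteMeasure ν']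
    (h : μ' Set.univ = ν' Set.univ) :
    genW 1 1 μ ν ≤ tvNorm μ μ' + tvNorm ν ν' + W1 μ' ν' := by
  refine csInf_le ⟨0, ?_⟩ ⟨μ', ν', inferInstance, inferInstance, h, by ring⟩
  rintro _ ⟨ρ, σ, -, -, -, rfl⟩
  linarith [tvNorm_nonneg μ ρ, tvNorm_nonneg ν σ, W1_nonneg ρ σ]

lemma mass_sub_le_genW_one (μ ν : Measure X) [IsFiniteMeasure μ] [IsFiniteMeasure ν] :
    ν.real Set.univ - μ.real Set.univ ≤ genW 1 1 μ ν := by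
  refine le_csInf ⟨_, 0, 0, inferInstance, inferInstance, rfl, rfl⟩ ?_
  rintro _ ⟨ρ, σ, hρ, hσ, h, rfl⟩
  have h' : ρ.real Set.univ = σ.real Set.univ := congrArg ENNReal.toReal h
  have h₁ := neg_le_of_abs_le (abs_sub_le_tvNorm μ ρ)
  have h₂ := le_of_abs_le (abs_sub_le_tvNorm ν σ)
  linarith [W1_nonneg ρ σ]

lemma signedW_sub_toSignedMeasure (μ ν ρ : Measure X) [IsFiniteMeasure μ] [IsFiniteMeasure ν]
    [IsFiniteMeasure ρ] :
    signedW 1 1 (μ.toSignedMeasure - ν.toSignedMeasure) ρ.toSignedMeasure =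
      genW 1 1 (μ - ν) (ν - μ + ρ) := by
  have hρ : ρ.toSignedMeasure.toJordanDecomposition =
      Measure.jordanDecompositionOfToSignedMeasureSub ρ 0 := by
    rw [← Measure.toJordanDecomposition_toSignedMeasure_sub, Measure.toSignedMeasure_zero, sub_zero]
  simp only [signedW, hρ, Measure.toJordanDecomposition_toSignedMeasure_sub,
    Measure.jordanDecompositionOfToSignedMeasureSub_posPart,
    Measure.jordanDecompositionOfToSignedMeasureSub_negPart, Measure.sub_zero, Measure.zero_sub, add_zero]

lemma le_signedW_sub (μ ν ρ : Measure X) [IsFiniteMeasure μ] [IsFiniteMeasure ν]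
    [IsFiniteMeasure ρ] :
    ρ.real Set.univ + ν.real Set.univ - μ.real Set.univ ≤
      signedW 1 1 (μ.toSignedMeasure - ν.toSignedMeasure) ρ.toSignedMeasure := by
  rw [signedW_sub_toSignedMeasure]
  refine le_trans ?_ (mass_sub_le_genW_one _ _)
  rw [measureReal_add_apply]
  linarith [measureReal_univ_sub_sub μ ν]

lemma signedW_sub_le {μ ν ρ p : Measure X} [IsFiniteMeasure μ] [IsFiniteMeasure ν]
    [IsFiniteMeasure ρ] [IsFiniteMeasure p] (hp : μ ≤ p) (h : p Set.univ = ρ Set.univ) :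
    signedW 1 1 (μ.toSignedMeasure - ν.toSignedMeasure) ρ.toSignedMeasure ≤
      ρ.real Set.univ + ν.real Set.univ - μ.real Set.univ + W1 p ρ := by
  rw [signedW_sub_toSignedMeasure]
  refine (genW_one_le _ _ p ρ h).trans ?_
  have h' : p.real Set.univ = ρ.real Set.univ := congrArg ENNReal.toReal h
  rw [tvNorm_of_le (Measure.sub_le.trans hp), tvNorm_comm,
    tvNorm_of_le (Measure.le_add_left le_rfl), measureReal_add_apply]
  linarith [measureReal_univ_sub_sub μ ν]

end GeneralizedWasserstein

section Counting

variable {X : Type*} [MeasurableSpace X]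

/-- The counting measure of the first `n` points of a sequence, scaled by `c`. -/
noncomputable def scaledCount (c : NNReal) (x : ℕ → X) (n : ℕ) : Measure X :=
  c • ∑ k ∈ Finset.range n, Measure.dirac (x k)

instance (c : NNReal) (x : ℕ → X) (n : ℕ) : IsFiniteMeasure (scaledCount c x n) := by
  unfold scaledCount
  infer_instance

lemma scaledCount_univ (c : NNReal) (x : ℕ → X) (n : ℕ) :
    scaledCount c x n Set.univ = c * n := by
  simp [scaledCount]
  rfl

lemma scaledCount_real_univ (c : NNReal) (x : ℕ → X) (n : ℕ) :
    (scaledCount c x n).real Set.univ = c * n := by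
  simp [Measure.real, scaledCount_univ]

lemma scaledCount_mono {c d : NNReal} (h : c ≤ d) (x : ℕ → X) (n : ℕ) :
    scaledCount c x n ≤ scaledCount d x n := by
  refine Measure.le_intro fun s _ _ => ?_
  simp only [scaledCount, Measure.smul_apply, ENNReal.smul_def, smul_eq_mul]
  gcongr

lemma toSignedMeasure_sum_dirac [MetricSpace X] (x : ℕ → X) (n : ℕ) :
    (∑ k ∈ Finset.range n, Measure.dirac (x k)).toSignedMeasure = sEmp x n := by
  unfold sEmp
  induction n with
  | zero => simp
  | succ n ih => simp only [Finset.sum_range_succ, Measure.toSignedMeasure_add, ih]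

lemma toSignedMeasure_scaledCount [MetricSpace X] (c : NNReal) (x : ℕ → X) (n : ℕ) :
    (scaledCount c x n).toSignedMeasure = (c : ℝ) • sEmp x n := by
  unfold scaledCount
  rw [Measure.toSignedMeasure_smul, toSignedMeasure_sum_dirac]
  rfl

lemma toSignedMeasure_scaledCount_sub [MetricSpace X] (c : NNReal) (x y : ℕ → X) (n m : ℕ) :
    (scaledCount c x n).toSignedMeasure - (scaledCount c y m).toSignedMeasure =
      (c : ℝ) • (sEmp x n - sEmp y m) := by
  rw [toSignedMeasure_scaledCount, toSignedMeasure_scaledCount, smul_sub]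

lemma emp_eq_scaledCount [MetricSpace X] (x : ℕ → X) {n : ℕ} (hn : n ≠ 0) :
    emp x n = scaledCount (n : NNReal)⁻¹ x n := by
  ext s _
  simp [emp, scaledCount, ENNReal.smul_def, ENNReal.coe_inv, hn]

end Counting

lemma exists_eventually_mul_le_of_one_lt_liminf {f : ℕ → ℕ}
    (hlim : 1 < Filter.liminf (fun N : ℕ => (f N : ℝ) / N) atTop) :
    ∃ c : ℝ, 1 < c ∧ ∀ᶠ N : ℕ in atTop, c * N ≤ f N := by
  rw [Filter.liminf_eq] at hlim
  have hne : {a : ℝ | ∀ᶠ N : ℕ in atTop, a ≤ (f N : ℝ) / N}.Nonempty :=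
    ⟨0, Eventually.of_forall fun N => by positivity⟩
  obtain ⟨c, hc, hc1⟩ := exists_lt_of_lt_csSup hne hlim
  refine ⟨c, hc1, ?_⟩
  filter_upwards [hc, eventually_gt_atTop 0] with N hN hN0
  rwa [le_div_iff₀ (by exact_mod_cast hN0)] at hN

/-- Same as Statement 12, but only assuming `f` is nondecreasing with
`liminf f(N)/N > 1`. -/
theorem rival_wins_of_liminf_growth {X : Type*} [MeasurableSpace X] [MetricSpace X]
    [BorelSpace X] [CompactSpace X] (dx : Measure X) [IsProbabilityMeasure dx]
    (hg : ∃ g : ℕ → X, Tendsto (fun n : ℕ => W1 (emp g n) dx) atTop (nhds 0))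
    (f : ℕ → ℕ) (hf : Monotone f)
    (hlim : 1 < Filter.liminf (fun N : ℕ => (f N : ℝ) / N) atTop) :
    ∃ N₀ : ℕ, ∀ x : ℕ → X, ∃ y : ℕ → X, ∀ N, N₀ ≤ N →
      signedW 1 1
          (((N + f N : ℕ) : ℝ)⁻¹ • (-(sEmp x N - sEmp y (f N))))
          dx.toSignedMeasure <
        signedW 1 1
          (((N + f N : ℕ) : ℝ)⁻¹ • (sEmp x N - sEmp y (f N)))
          dx.toSignedMeasure := by
  obtain ⟨g, hg⟩ := hg
  obtain ⟨c, hc, hfc⟩ := exists_eventually_mul_le_of_one_lt_liminf hlim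
  have hftop : Tendsto f atTop atTop := by
    refine tendsto_atTop_mono' atTop ?_ tendsto_id
    filter_upwards [hfc] with N hN
    have hN' : (N : ℝ) ≤ f N := le_trans (le_mul_of_one_le_left N.cast_nonneg hc.le) hN
    exact_mod_cast hN'
  have hsmall : ∀ᶠ N in atTop, W1 (emp g (f N)) dx < 2 * ((c - 1) / (c + 1)) :=
    (hg.comp hftop).eventually_lt_const
      (mul_pos two_pos (div_pos (sub_pos.2 hc) (by linarith)))
  obtain ⟨N₀, hN₀⟩ := eventually_atTop.1 (hfc.and (hsmall.and (eventually_gt_atTop 0)))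
  refine ⟨N₀, fun x => ⟨g, fun N hN => ?_⟩⟩
  obtain ⟨hcN, hW, hNpos⟩ := hN₀ N hN
  have hNpos' : (0 : ℝ) < N := by exact_mod_cast hNpos
  have hfpos' : (0 : ℝ) < f N := by nlinarith
  have hfpos : 0 < f N := by exact_mod_cast hfpos'
  set t : NNReal := ((N + f N : ℕ) : NNReal)⁻¹ with ht
  have htR : (t : ℝ) = ((N + f N : ℕ) : ℝ)⁻¹ := by simp [ht]
  have hle : scaledCount t g (f N) ≤ emp g (f N) := by
    rw [emp_eq_scaledCount g hfpos.ne']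
    refine scaledCount_mono (inv_anti₀ (by exact_mod_cast hfpos) ?_) _ _
    exact_mod_cast Nat.le_add_left _ _
  have : IsFiniteMeasure (emp g (f N)) := by
    rw [emp_eq_scaledCount g hfpos.ne']
    infer_instance
  have hmass : emp g (f N) Set.univ = dx Set.univ := by
    rw [emp_eq_scaledCount g hfpos.ne', scaledCount_univ, measure_univ,
      ENNReal.coe_inv (by exact_mod_cast hfpos.ne'), ENNReal.coe_natCast]
    exact ENNReal.inv_mul_cancel (by exact_mod_cast hfpos.ne') (ENNReal.natCast_ne_top _)
  have hup := signedW_sub_le (ν := scaledCount t x N) hle hmass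
  have hlow := le_signedW_sub (scaledCount t x N) (scaledCount t g (f N)) dx
  rw [toSignedMeasure_scaledCount_sub, scaledCount_real_univ, scaledCount_real_univ, htR] at hup hlow
  rw [neg_sub]
  refine hup.trans_lt (lt_of_lt_of_le ?_ hlow)
  have key : (c - 1) / (c + 1) ≤ ((N + f N : ℕ) : ℝ)⁻¹ * (f N - N) := by
    push_cast
    rw [inv_mul_eq_div, div_le_div_iff₀ (by linarith) (by linarith)]
    linarith
  linarith
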